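/- There exists an absolute constant c > 0 such that the following holds. Let q ≡ 3 (mod 4) be a prime power and let A be a multiplicative subgroup of F_q^* with |A| ≥ q^{2/3}. For any 0 < δ ≤ 1 there exists an integer q₀ = q₀(δ) with the following property: if q ≥ q₀ and X is a subset of the paraboloid P ⊂ F_q³ with |X| ≥ δ·q², then the number of non-trivial energy tuples (a, b, c, d) ∈ X⁴ such that the four projected points a̲, c̲, b̲, d̲ form a rectangle in F_q² with both side-lengths in A is at least c·|X|⁴·|A|²/q⁵. -/

import Mathlib

/-- The paraboloid `z = x² + y²` in `F³`. -/
def Paraboloid (F : Type) [Field F] : Set (F × F × F) :=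
  {p | p.2.2 = p.1 ^ 2 + p.2.1 ^ 2}

/-- Projection of a point of `F³` onto its first two coordinates. -/
def proj {F : Type} [Field F] (p : F × F × F) : F × F := (p.1, p.2.1)

/-- The standard dot product on `F²`. -/
def dot2 {F : Type} [Field F] (u v : F × F) : F := u.1 * v.1 + u.2 * v.2

/-- Four points `x, z, y, t` of `F²` form a rectangle in this cyclic order. -/
def IsRect {F : Type} [Field F] (x z y t : F × F) : Prop :=
  dot2 (x - z) (y - z) = 0 ∧ dot2 (z - y) (t - y) = 0 ∧
    dot2 (y - t) (x - t) = 0 ∧ dot2 (t - x) (z - x) = 0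

/-- `(a, b, c, d)` is a non-trivial energy tuple: `a + b = c + d` and `a, b, c, d`
are pairwise distinct. -/
def IsNontrivialEnergyTuple {F : Type} [Field F] (a b c d : F × F × F) : Prop :=
  a + b = c + d ∧ a ≠ b ∧ a ≠ c ∧ a ≠ d ∧ b ≠ c ∧ b ≠ d ∧ c ≠ d

open Finset in
/-- The dilates of `x ↦ g (x + ·)` by distinct scalars are orthogonal when `g` has mean zero. -/
theorem sum_shift_mul_shift_eq_zero {F : Type} [Field F] [Fintype F] {g : F → ℝ}
    (hg : ∑ x, g x = 0) {s r : F} (hsr : s ≠ r) :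
    ∑ x, ∑ t, g (x + s * t) * g (x + r * t) = 0 := by
  have shift (t : F) : ∑ x, g (x + s * t) * g (x + r * t) = ∑ x, g x * g (x + (r - s) * t) := by
    rw [← Equiv.sum_comp (Equiv.addRight (s * t)) (fun x => g x * g (x + (r - s) * t))]
    refine sum_congr rfl fun x _ => ?_
    simp only [Equiv.coe_addRight]
    ring_nf
  have line (x : F) : ∑ t, g (x + (r - s) * t) = 0 := by
    rw [← hg, ← Equiv.sum_comp ((Equiv.mulLeft₀ (r - s) (sub_ne_zero.2 hsr.symm)).trans
      (Equiv.addLeft x)) g]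
    rfl
  rw [sum_comm]
  simp_rw [shift]
  rw [sum_comm]
  simp_rw [← mul_sum, line, mul_zero, sum_const_zero]

open Finset in
theorem sum_sq_sum_dilates {F : Type} [Field F] [Fintype F] (A : Subgroup Fˣ) [Fintype A]
    {g : F → ℝ} (hg : ∑ x, g x = 0) :
    ∑ x, ∑ t, (∑ s : A, g (x + ((s : Fˣ) : F) * t)) ^ 2 =
      Fintype.card A * (Fintype.card F * ∑ x, g x ^ 2) := by
  classical
  have diag (s : F) : ∑ x, ∑ t, g (x + s * t) * g (x + s * t) =
      Fintype.card F * ∑ x, g x ^ 2 := by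
    rw [sum_comm]
    have (t : F) : ∑ x, g (x + s * t) * g (x + s * t) = ∑ x, g x ^ 2 := by
      rw [← Equiv.sum_comp (Equiv.addRight (s * t)) (fun x => g x ^ 2)]
      simp [sq]
    simp [this]
  calc ∑ x, ∑ t, (∑ s : A, g (x + ((s : Fˣ) : F) * t)) ^ 2
      = ∑ s : A, ∑ r : A, ∑ x, ∑ t,
          g (x + ((s : Fˣ) : F) * t) * g (x + ((r : Fˣ) : F) * t) := by
        simp_rw [sq, sum_mul_sum]
        rw [sum_congr rfl fun x _ => sum_comm, sum_comm]
        refine sum_congr rfl fun s _ => ?_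
        rw [sum_congr rfl fun x _ => sum_comm, sum_comm]
    _ = ∑ s : A, ∑ r : A, if s = r then Fintype.card F * ∑ x, g x ^ 2 else 0 := by
        refine sum_congr rfl fun s _ => sum_congr rfl fun r _ => ?_
        split_ifs with h
        · rw [h, diag]
        · exact sum_shift_mul_shift_eq_zero hg fun h' => h (Subtype.ext (Units.ext h'))
    _ = _ := by simp

open Finset in
/-- The Cayley graph of a multiplicative subgroup has second eigenvalue at most `√q`. -/
theorem sq_sum_mul_shift_le {F : Type} [Field F] [Fintype F] (A : Subgroup Fˣ) [Fintype A]
    {g : F → ℝ} (hg : ∑ x, g x = 0) :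
    (∑ x, ∑ t : A, g x * g (x + ((t : Fˣ) : F))) ^ 2 ≤
      Fintype.card F * (∑ x, g x ^ 2) ^ 2 := by
  classical
  set R := ∑ x, ∑ t : A, g x * g (x + ((t : Fˣ) : F)) with hR
  set G := ∑ x, g x ^ 2 with hG
  have hA : (0 : ℝ) < Fintype.card A := by exact_mod_cast Fintype.card_pos
  have dilate (s : A) :
      ∑ x, ∑ t : A, g x * g (x + ((s : Fˣ) : F) * ((t : Fˣ) : F)) = R := by
    refine sum_congr rfl fun x _ => ?_
    rw [← Equiv.sum_comp (Equiv.mulLeft s) (fun t : A => g x * g (x + ((t : Fˣ) : F)))]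
    simp
  have expand : Fintype.card A * R =
      ∑ p : F × A, g p.1 * ∑ s : A, g (p.1 + ((s : Fˣ) : F) * ((p.2 : Fˣ) : F)) := by
    rw [Fintype.sum_prod_type]
    simp_rw [mul_sum]
    rw [sum_congr rfl fun x _ => sum_comm, sum_comm]
    simp [dilate]
  have cs := sum_mul_sq_le_sq_mul_sq univ (fun p : F × A => g p.1)
    (fun p : F × A => ∑ s : A, g (p.1 + ((s : Fˣ) : F) * ((p.2 : Fˣ) : F)))
  have first : ∑ p : F × A, g p.1 ^ 2 = Fintype.card A * G := by
    rw [Fintype.sum_prod_type]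
    simp [← mul_sum, hG]
  have second : ∑ p : F × A, (∑ s : A, g (p.1 + ((s : Fˣ) : F) * ((p.2 : Fˣ) : F))) ^ 2 ≤
      Fintype.card A * (Fintype.card F * G) := by
    rw [Fintype.sum_prod_type, ← sum_sq_sum_dilates A hg]
    refine sum_le_sum fun x _ => ?_
    let e : A ↪ F := ⟨fun a => ((a : Fˣ) : F), fun a b h => Subtype.ext (Units.ext h)⟩
    calc ∑ t : A, (∑ s : A, g (x + ((s : Fˣ) : F) * ((t : Fˣ) : F))) ^ 2
        = ∑ t ∈ univ.map e, (∑ s : A, g (x + ((s : Fˣ) : F) * t)) ^ 2 := by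
          rw [sum_map]
          rfl
      _ ≤ _ := sum_le_sum_of_subset_of_nonneg (subset_univ _) fun _ _ _ => sq_nonneg _
  rw [← expand, first] at cs
  have hG0 : 0 ≤ G := sum_nonneg fun _ _ => sq_nonneg _
  have bound := cs.trans (mul_le_mul_of_nonneg_left second (by positivity))
  refine le_of_mul_le_mul_left ?_ (pow_pos hA 2)
  calc _ = (Fintype.card A * R) ^ 2 := by ring
    _ ≤ _ := bound
    _ = _ := by ring

open Finset in
/-- Expander mixing lower bound for the Cayley graph of a multiplicative subgroup. -/
theorem le_sum_mul_shift {F : Type} [Field F] [Fintype F] (A : Subgroup Fˣ) [Fintype A]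
    (f : F → ℝ) :
    Fintype.card A / Fintype.card F * (∑ x, f x) ^ 2 - √(Fintype.card F) * ∑ x, f x ^ 2 ≤
      ∑ x, ∑ t : A, f x * f (x + ((t : Fˣ) : F)) := by
  have hq : (0 : ℝ) < Fintype.card F := by exact_mod_cast Fintype.card_pos
  set q : ℝ := (Fintype.card F : ℝ) with hq_def
  set N := ∑ x, f x with hN
  set μ := N / q with hμ
  have hμq : q * μ = N := by rw [hμ]; field_simp
  have mean : ∑ x, (f x - μ) = 0 := by
    rw [sum_sub_distrib]
    simp [← hq_def, ← hN, hμq]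
  have norm_le : ∑ x, (f x - μ) ^ 2 ≤ ∑ x, f x ^ 2 := by
    have : ∑ x, (f x - μ) ^ 2 = ∑ x, f x ^ 2 - q * μ ^ 2 := by
      simp_rw [sub_sq]
      rw [sum_add_distrib, sum_sub_distrib]
      simp only [← mul_sum, ← sum_mul, sum_const, card_univ, nsmul_eq_mul, ← hq_def, ← hN, ← hμq]
      ring
    rw [this]
    nlinarith [sq_nonneg μ]
  have shift (t : F) : ∑ x, f (x + t) = N := Equiv.sum_comp (Equiv.addRight t) f
  have decomp : ∑ x, ∑ t : A, (f x - μ) * (f (x + ((t : Fˣ) : F)) - μ) =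
      ∑ x, ∑ t : A, f x * f (x + ((t : Fˣ) : F)) - Fintype.card A / q * N ^ 2 := by
    have row (t : F) : ∑ x, (f x - μ) * (f (x + t) - μ) =
        ∑ x, f x * f (x + t) - N ^ 2 / q := by
      have : ∀ x, (f x - μ) * (f (x + t) - μ) =
          f x * f (x + t) - μ * f x - μ * f (x + t) + μ ^ 2 := fun x => by ring
      simp_rw [this]
      rw [sum_add_distrib, sum_sub_distrib, sum_sub_distrib, ← mul_sum, ← mul_sum, shift]
      simp only [sum_const, card_univ, nsmul_eq_mul, ← hq_def, ← hN]
      rw [hμ]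
      field_simp
      ring
    rw [sum_comm, sum_congr rfl fun t _ => row _, sum_sub_distrib, sum_comm]
    simp
    ring
  have key := sq_sum_mul_shift_le A mean
  have hsq : q * (∑ x, (f x - μ) ^ 2) ^ 2 = (√q * ∑ x, (f x - μ) ^ 2) ^ 2 := by
    rw [mul_pow, Real.sq_sqrt hq.le]
  rw [← hq_def, hsq, decomp] at key
  have hnonneg : 0 ≤ √q * ∑ x, (f x - μ) ^ 2 :=
    mul_nonneg (Real.sqrt_nonneg _) (sum_nonneg fun _ _ => sq_nonneg _)
  have := (abs_le_of_sq_le_sq' key hnonneg).1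
  have := mul_le_mul_of_nonneg_left norm_le (Real.sqrt_nonneg q)
  linarith

open Finset in
/-- Lower bound for the number of axis-parallel rectangles with side vectors in `A` inside a dense
subset of `F²` with indicator function `f`. -/
theorem le_sum_axis_rectangles {F : Type} [Field F] [Fintype F] (A : Subgroup Fˣ) [Fintype A]
    (f : F → F → ℝ) (hf : ∀ x y, f x y ^ 2 = f x y) {N : ℝ} (hN : ∑ x, ∑ y, f x y = N)
    (h₁ : 2 * √(Fintype.card F) * (Fintype.card F : ℝ) ^ 2 ≤ Fintype.card A * N)
    (h₂ : 4 * √(Fintype.card F) * (Fintype.card F : ℝ) ^ 4 ≤ Fintype.card A * N ^ 2) :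
    (Fintype.card A : ℝ) ^ 2 * N ^ 4 / (8 * (Fintype.card F : ℝ) ^ 6) ≤
      ∑ x, ∑ s : A, ∑ y, ∑ t : A, f x y * f (x + ((s : Fˣ) : F)) y *
        (f x (y + ((t : Fˣ) : F)) * f (x + ((s : Fˣ) : F)) (y + ((t : Fˣ) : F))) := by
  have hq : (0 : ℝ) < Fintype.card F := by exact_mod_cast Fintype.card_pos
  have hn : (0 : ℝ) < Fintype.card A := by exact_mod_cast Fintype.card_pos
  have hf0 (x y : F) : 0 ≤ f x y := hf x y ▸ sq_nonneg _
  have hN0 : 0 ≤ N := hN ▸ sum_nonneg fun x _ => sum_nonneg fun y _ => hf0 x y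
  set q : ℝ := (Fintype.card F : ℝ) with hq_def
  set n : ℝ := (Fintype.card A : ℝ) with hn_def
  set g : F × A → ℝ := fun p => ∑ y, f p.1 y * f (p.1 + ((p.2 : Fˣ) : F)) y with hg
  set M := ∑ p, g p with hM
  have le_M : n * N ^ 2 / (2 * q ^ 2) ≤ M := by
    have rows : M = ∑ y, ∑ x, ∑ s : A, f x y * f (x + ((s : Fˣ) : F)) y := by
      rw [hM, Fintype.sum_prod_type, sum_congr rfl fun x _ => sum_comm, sum_comm]
    have cs : N ^ 2 ≤ q * ∑ y, (∑ x, f x y) ^ 2 := by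
      have := sq_sum_le_card_mul_sum_sq (s := (univ : Finset F)) (f := fun y => ∑ x, f x y)
      rwa [sum_comm, hN, card_univ] at this
    have mixing : n / q * ∑ y, (∑ x, f x y) ^ 2 - √q * N ≤ M := by
      have : √q * N = ∑ y, √q * ∑ x, f x y ^ 2 := by
        rw [← hN, sum_comm, mul_sum]
        simp_rw [hf]
      rw [rows, this, mul_sum, ← sum_sub_distrib]
      exact sum_le_sum fun y _ => le_sum_mul_shift A fun x => f x y
    have main : n * N ^ 2 / q ^ 2 ≤ n / q * ∑ y, (∑ x, f x y) ^ 2 := by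
      calc n * N ^ 2 / q ^ 2 ≤ n * (q * ∑ y, (∑ x, f x y) ^ 2) / q ^ 2 := by gcongr
        _ = _ := by field_simp
    have error : √q * N ≤ n * N ^ 2 / (2 * q ^ 2) := by
      rw [le_div_iff₀ (by positivity)]
      nlinarith [mul_le_mul_of_nonneg_right h₁ hN0]
    have : n * N ^ 2 / q ^ 2 = 2 * (n * N ^ 2 / (2 * q ^ 2)) := by field_simp
    linarith
  have hM0 : 0 ≤ M := le_trans (by positivity) le_M
  have mixing : n / q * ∑ p, g p ^ 2 - √q * M ≤
      ∑ x, ∑ s : A, ∑ y, ∑ t : A, f x y * f (x + ((s : Fˣ) : F)) y *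
        (f x (y + ((t : Fˣ) : F)) * f (x + ((s : Fˣ) : F)) (y + ((t : Fˣ) : F))) := by
    rw [← Fintype.sum_prod_type' (f := fun x (s : A) => ∑ y, ∑ t : A,
      f x y * f (x + ((s : Fˣ) : F)) y *
        (f x (y + ((t : Fˣ) : F)) * f (x + ((s : Fˣ) : F)) (y + ((t : Fˣ) : F)))),
      hM, mul_sum, mul_sum, ← sum_sub_distrib]
    refine sum_le_sum fun p _ => ?_
    have := le_sum_mul_shift A fun y => f p.1 y * f (p.1 + ((p.2 : Fˣ) : F)) y
    simp_rw [mul_pow, hf] at this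
    exact this
  have cs : M ^ 2 ≤ q * n * ∑ p, g p ^ 2 := by
    have := sq_sum_le_card_mul_sum_sq (s := (univ : Finset (F × A))) (f := g)
    rwa [card_univ, Fintype.card_prod, Nat.cast_mul] at this
  have main : M ^ 2 / q ^ 2 ≤ n / q * ∑ p, g p ^ 2 := by
    calc M ^ 2 / q ^ 2 ≤ q * n * (∑ p, g p ^ 2) / q ^ 2 := by gcongr
      _ = _ := by field_simp
  have large : 2 * √q * q ^ 2 ≤ M := by
    refine le_trans ?_ le_M
    rw [le_div_iff₀ (by positivity)]
    linarith
  have error : √q * M ≤ M ^ 2 / (2 * q ^ 2) := by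
    rw [le_div_iff₀ (by positivity)]
    nlinarith [mul_le_mul_of_nonneg_right large hM0]
  have half : M ^ 2 / q ^ 2 = 2 * (M ^ 2 / (2 * q ^ 2)) := by field_simp
  have final : n ^ 2 * N ^ 4 / (8 * q ^ 6) ≤ M ^ 2 / (2 * q ^ 2) := by
    calc n ^ 2 * N ^ 4 / (8 * q ^ 6) = (n * N ^ 2 / (2 * q ^ 2)) ^ 2 / (2 * q ^ 2) := by
          field_simp; norm_num
      _ ≤ _ := by gcongr
  linarith

/-- The point of the paraboloid above a point of the plane. -/
def liftParaboloid {F : Type} [Field F] (p : F × F) : F × F × F :=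
  (p.1, p.2, p.1 ^ 2 + p.2 ^ 2)

/-- Multiplication by `w` when `F²` is identified with `F(i)`. -/
def rotate {F : Type} [Field F] (w p : F × F) : F × F :=
  (w.1 * p.1 - w.2 * p.2, w.2 * p.1 + w.1 * p.2)

/-- The rational parametrization of the unit circle. -/
def circlePoint {F : Type} [Field F] (m : F) : F × F :=
  ((1 - m ^ 2) / (1 + m ^ 2), 2 * m / (1 + m ^ 2))

section Geometry

variable {F : Type} [Field F]

theorem liftParaboloid_injective : Function.Injective (liftParaboloid (F := F)) := by
  intro p r h
  simp only [liftParaboloid, Prod.mk.injEq] at h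
  exact Prod.ext h.1 h.2.1

theorem liftParaboloid_proj {p : F × F × F} (hp : p ∈ Paraboloid F) :
    liftParaboloid (proj p) = p :=
  Prod.ext rfl (Prod.ext rfl (Eq.symm hp))

theorem rotate_injective {w : F × F} (hw : w.1 ^ 2 + w.2 ^ 2 = 1) :
    Function.Injective (rotate w) := by
  intro p r h
  simp only [rotate, Prod.mk.injEq] at h
  obtain ⟨h₁, h₂⟩ := h
  refine Prod.ext ?_ ?_
  · linear_combination w.1 * h₁ + w.2 * h₂ - (p.1 - r.1) * hw
  · linear_combination w.1 * h₂ - w.2 * h₁ - (p.2 - r.2) * hw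

theorem circlePoint_norm {m : F} (hm : 1 + m ^ 2 ≠ 0) :
    (circlePoint m).1 ^ 2 + (circlePoint m).2 ^ 2 = 1 := by
  simp only [circlePoint]
  field_simp
  ring

theorem circlePoint_injective (h2 : (2 : F) ≠ 0) (h : ∀ m : F, 1 + m ^ 2 ≠ 0) :
    Function.Injective (circlePoint (F := F)) := by
  intro m n hmn
  have slope (k : F) : (circlePoint k).2 = k * (1 + (circlePoint k).1) := by
    have := h k
    simp only [circlePoint]
    field_simp
    ring
  have height (k : F) : 1 + (circlePoint k).1 ≠ 0 := by
    have : 1 + (circlePoint k).1 = 2 / (1 + k ^ 2) := by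
      have := h k
      simp only [circlePoint]
      field_simp
      ring
    rw [this]
    exact div_ne_zero h2 (h k)
  have hm := slope m
  rw [hmn, slope n] at hm
  exact (mul_right_cancel₀ (height n) hm).symm

theorem isNontrivialEnergyTuple_rotate {w : F × F} (hw : w.1 ^ 2 + w.2 ^ 2 = 1) {x y s t : F}
    (hs : s ≠ 0) (ht : t ≠ 0) :
    IsNontrivialEnergyTuple (liftParaboloid (rotate w (x, y)))
      (liftParaboloid (rotate w (x + s, y + t))) (liftParaboloid (rotate w (x + s, y)))
      (liftParaboloid (rotate w (x, y + t))) := by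
  have inj := liftParaboloid_injective.comp (rotate_injective hw)
  refine ⟨?_, inj.ne ?_, inj.ne ?_, inj.ne ?_, inj.ne ?_, inj.ne ?_, inj.ne ?_⟩
  · simp only [liftParaboloid, rotate, Prod.mk_add_mk, Prod.mk.injEq]
    refine ⟨by ring, by ring, by ring⟩
  all_goals simp [hs, ht]

theorem isRect_rotate (w : F × F) (x y s t : F) :
    IsRect (rotate w (x, y)) (rotate w (x + s, y)) (rotate w (x + s, y + t))
      (rotate w (x, y + t)) := by
  simp only [IsRect, dot2, rotate, Prod.fst_sub, Prod.snd_sub]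
  refine ⟨by ring, by ring, by ring, by ring⟩

theorem dot2_rotate_sub {w : F × F} (hw : w.1 ^ 2 + w.2 ^ 2 = 1) (p r : F × F) :
    dot2 (rotate w p - rotate w r) (rotate w p - rotate w r) =
      (p.1 - r.1) ^ 2 + (p.2 - r.2) ^ 2 := by
  simp only [dot2, rotate, Prod.fst_sub, Prod.snd_sub]
  linear_combination ((p.1 - r.1) ^ 2 + (p.2 - r.2) ^ 2) * hw

end Geometry

theorem quadraticChar_neg_of_card {F : Type} [Field F] [Fintype F] [DecidableEq F]
    (hF : Fintype.card F % 4 = 3) (a : F) : quadraticChar F (-a) = -quadraticChar F a := by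
  have : quadraticChar F (-1) = -1 := by
    rw [quadraticChar_neg_one_iff_not_isSquare, FiniteField.isSquare_neg_one_iff]
    simp [hF]
  rw [neg_eq_neg_one_mul, map_mul, this, neg_one_mul]

theorem one_add_sq_ne_zero_of_card {F : Type} [Field F] [Fintype F]
    (hF : Fintype.card F % 4 = 3) (m : F) : 1 + m ^ 2 ≠ 0 := by
  intro h
  have : IsSquare (-1 : F) := ⟨m, by linear_combination -h⟩
  exact FiniteField.isSquare_neg_one_iff.1 this hF

theorem two_ne_zero_of_card {F : Type} [Field F] [Fintype F]
    (hF : Fintype.card F % 4 = 3) : (2 : F) ≠ 0 := by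
  refine Ring.two_ne_zero fun h => ?_
  have := FiniteField.even_card_of_char_two h
  omega

/-- The energy tuples of `X` counted in the main theorem. -/
def rectangleTuples {F : Type} [Field F] (A : Subgroup Fˣ) (X : Set (F × F × F)) :
    Set ((F × F × F) × (F × F × F) × (F × F × F) × (F × F × F)) :=
  {t | t.1 ∈ X ∧ t.2.1 ∈ X ∧ t.2.2.1 ∈ X ∧ t.2.2.2 ∈ X ∧
    IsNontrivialEnergyTuple t.1 t.2.1 t.2.2.1 t.2.2.2 ∧
    IsRect (proj t.1) (proj t.2.2.1) (proj t.2.1) (proj t.2.2.2) ∧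
    (∃ u ∈ A, (u : F) =
      dot2 (proj t.1 - proj t.2.2.1) (proj t.1 - proj t.2.2.1)) ∧
    (∃ u ∈ A, (u : F) =
      dot2 (proj t.2.2.1 - proj t.2.1) (proj t.2.2.1 - proj t.2.1))}

/-- The rectangle with corner `rotate w (x, y)` and sides `s` and `t` along `w` and its normal, as
a tuple of points of the paraboloid. -/
def rotatedTuple {F : Type} [Field F] (w : F × F) (x s y t : F) :
    (F × F × F) × (F × F × F) × (F × F × F) × (F × F × F) :=
  (liftParaboloid (rotate w (x, y)), liftParaboloid (rotate w (x + s, y + t)),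
    liftParaboloid (rotate w (x + s, y)), liftParaboloid (rotate w (x, y + t)))

theorem rotatedTuple_mem_rectangleTuples {F : Type} [Field F] {A : Subgroup Fˣ}
    {X : Set (F × F × F)} {w : F × F} (hw : w.1 ^ 2 + w.2 ^ 2 = 1) {x y : F} {s t : Fˣ}
    (hs : s ∈ A) (ht : t ∈ A) (h₁ : liftParaboloid (rotate w (x, y)) ∈ X)
    (h₂ : liftParaboloid (rotate w (x + s, y)) ∈ X)
    (h₃ : liftParaboloid (rotate w (x, y + t)) ∈ X)
    (h₄ : liftParaboloid (rotate w (x + s, y + t)) ∈ X) :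
    rotatedTuple w x s y t ∈ rectangleTuples A X := by
  have hproj (p : F × F) : proj (liftParaboloid p) = p := rfl
  refine ⟨h₁, h₄, h₂, h₃, isNontrivialEnergyTuple_rotate hw s.ne_zero t.ne_zero, ?_,
    ⟨s ^ 2, pow_mem hs 2, ?_⟩, ⟨t ^ 2, pow_mem ht 2, ?_⟩⟩
  · exact isRect_rotate w x y s t
  · simp only [rotatedTuple, hproj, dot2_rotate_sub hw]
    push_cast
    ring
  · simp only [rotatedTuple, hproj, dot2_rotate_sub hw]
    push_cast
    ring

/-- A rectangle determines its parameters up to replacing the direction by its opposite. -/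
theorem rotatedTuple_inj {F : Type} [Field F] {w v : F × F} (hw : w.1 ^ 2 + w.2 ^ 2 = 1)
    (hv : v.1 ^ 2 + v.2 ^ 2 = 1) {x s y t x' s' y' t' : F} (hs : s ≠ 0)
    (h : rotatedTuple w x s y t = rotatedTuple v x' s' y' t') (hss : s' ≠ -s) :
    w = v ∧ x = x' ∧ s = s' ∧ y = y' ∧ t = t' := by
  simp only [rotatedTuple, Prod.mk.injEq, liftParaboloid_injective.eq_iff] at h
  obtain ⟨ha, -, hc, hd⟩ := h
  have side : s ^ 2 = s' ^ 2 := by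
    have e := dot2_rotate_sub hw (x + s, y) (x, y)
    rw [ha, hc, dot2_rotate_sub hv] at e
    linear_combination -e
  obtain rfl : s = s' := by
    rcases sq_eq_sq_iff_eq_or_eq_neg.1 side with h | h
    · exact h
    · exact (hss (by rw [h, neg_neg])).elim
  have hwv : w = v := by
    simp only [rotate, Prod.mk.injEq] at ha hc
    refine Prod.ext (mul_right_cancel₀ hs ?_) (mul_right_cancel₀ hs ?_)
    · linear_combination hc.1 - ha.1
    · linear_combination hc.2 - ha.2
  subst hwv
  have h₁ := rotate_injective hw ha
  have h₂ := rotate_injective hw hd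
  simp only [Prod.mk.injEq] at h₁ h₂
  exact ⟨rfl, h₁.1, rfl, h₁.2, by linear_combination h₂.2 - h₁.2⟩

open Finset in
open Classical in
theorem sum_indicator_rotate {F : Type} [Field F] [Fintype F] {X : Set (F × F × F)}
    (hX : X ⊆ Paraboloid F) {w : F × F} (hw : w.1 ^ 2 + w.2 ^ 2 = 1) :
    ∑ x, ∑ y, (if liftParaboloid (rotate w (x, y)) ∈ X then (1 : ℝ) else 0) = X.ncard := by
  have hinj : Function.Injective fun p => liftParaboloid (rotate w p) :=
    liftParaboloid_injective.comp (rotate_injective hw)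
  have himage : X = (fun p => liftParaboloid (rotate w p)) ''
      {p | liftParaboloid (rotate w p) ∈ X} := by
    ext a
    constructor
    · intro ha
      obtain ⟨p, hp⟩ := (Finite.injective_iff_surjective.1 (rotate_injective hw)) (proj a)
      have : liftParaboloid (rotate w p) = a := by rw [hp, liftParaboloid_proj (hX ha)]
      exact ⟨p, by simpa [this] using ha, this⟩
    · rintro ⟨p, hp, rfl⟩
      exact hp
  have hcard : X.ncard = #{p : F × F | liftParaboloid (rotate w p) ∈ X} := by
    conv_lhs => rw [himage]
    rw [Set.ncard_image_of_injective _ hinj, ← Set.ncard_coe_finset]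
    simp
  rw [hcard, ← Fintype.sum_prod_type' (f := fun x y =>
    if liftParaboloid (rotate w (x, y)) ∈ X then (1 : ℝ) else 0), natCast_card_filter]

open Finset in
open Classical in
/-- Each rectangle arises from at most two choices of parameters. -/
theorem sum_rotated_rectangles_le {F : Type} [Field F] [Fintype F]
    (hF : Fintype.card F % 4 = 3) (A : Subgroup Fˣ) [Fintype A] (X : Set (F × F × F))
    (f : F → F → F → ℝ) (hf : ∀ m x y, f m x y =
      if liftParaboloid (rotate (circlePoint m) (x, y)) ∈ X then 1 else 0) :
    ∑ m, ∑ x, ∑ s : A, ∑ y, ∑ t : A, f m x y * f m (x + ((s : Fˣ) : F)) y *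
        (f m x (y + ((t : Fˣ) : F)) * f m (x + ((s : Fˣ) : F)) (y + ((t : Fˣ) : F))) ≤
      2 * (rectangleTuples A X).ncard := by
  set D : Finset (F × F × A × F × A) := {p |
    liftParaboloid (rotate (circlePoint p.1) (p.2.1, p.2.2.2.1)) ∈ X ∧
    liftParaboloid (rotate (circlePoint p.1) (p.2.1 + ((p.2.2.1 : Fˣ) : F), p.2.2.2.1)) ∈ X ∧
    liftParaboloid (rotate (circlePoint p.1) (p.2.1, p.2.2.2.1 + ((p.2.2.2.2 : Fˣ) : F))) ∈ X ∧
    liftParaboloid (rotate (circlePoint p.1)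
      (p.2.1 + ((p.2.2.1 : Fˣ) : F), p.2.2.2.1 + ((p.2.2.2.2 : Fˣ) : F))) ∈ X} with hD
  have hsum : ∑ m, ∑ x, ∑ s : A, ∑ y, ∑ t : A, f m x y * f m (x + ((s : Fˣ) : F)) y *
      (f m x (y + ((t : Fˣ) : F)) * f m (x + ((s : Fˣ) : F)) (y + ((t : Fˣ) : F))) = #D := by
    rw [hD, natCast_card_filter]
    simp_rw [Fintype.sum_prod_type, hf, ite_and]
    refine sum_congr rfl fun m _ => sum_congr rfl fun x _ => sum_congr rfl fun s _ =>
      sum_congr rfl fun y _ => sum_congr rfl fun t _ => ?_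
    split_ifs <;> simp
  have hcircle (m : F) := circlePoint_norm (one_add_sq_ne_zero_of_card hF m)
  have hcard : #D ≤ (rectangleTuples A X ×ˢ (Set.univ : Set Bool)).ncard := by
    rw [← Set.ncard_coe_finset]
    refine Set.ncard_le_ncard_of_injOn (fun p =>
      (rotatedTuple (circlePoint p.1) p.2.1 ((p.2.2.1 : Fˣ) : F) p.2.2.2.1 ((p.2.2.2.2 : Fˣ) : F),
        decide (quadraticChar F ((p.2.2.1 : Fˣ) : F) = 1))) ?_ ?_ (Set.toFinite _)
    · rintro ⟨m, x, s, y, t⟩ hp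
      obtain ⟨h₁, h₂, h₃, h₄⟩ := (mem_filter.1 (mem_coe.1 hp)).2
      exact ⟨rotatedTuple_mem_rectangleTuples (hcircle m) s.2 t.2 h₁ h₂ h₃ h₄, Set.mem_univ _⟩
    · rintro ⟨m, x, s, y, t⟩ - ⟨m', x', s', y', t'⟩ - h
      simp only [Prod.mk.injEq, decide_eq_decide] at h
      obtain ⟨h, hχ⟩ := h
      have hneg : ((s' : Fˣ) : F) ≠ -((s : Fˣ) : F) := by
        intro hss
        rw [hss, quadraticChar_neg_of_card hF] at hχ
        rcases quadraticChar_dichotomy (s : Fˣ).ne_zero with h' | h' <;> simp [h'] at hχ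
      obtain ⟨hw, hx, hs, hy, ht⟩ :=
        rotatedTuple_inj (hcircle m) (hcircle m') (s : Fˣ).ne_zero h hneg
      have hm := circlePoint_injective (two_ne_zero_of_card hF) (one_add_sq_ne_zero_of_card hF) hw
      simp only [Prod.mk.injEq]
      exact ⟨hm, hx, Subtype.ext (Units.ext hs), hy, Subtype.ext (Units.ext ht)⟩
  have hprod : (rectangleTuples A X ×ˢ (Set.univ : Set Bool)).ncard =
      2 * (rectangleTuples A X).ncard := by
    rw [Set.ncard_prod, Set.ncard_univ, Nat.card_eq_fintype_card, Fintype.card_bool, mul_comm]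
  rw [hsum]
  exact_mod_cast hcard.trans_eq hprod

theorem four_mul_sqrt_le {δ q : ℝ} (hδ : 0 < δ) (hq : (4 / δ ^ 2) ^ 6 ≤ q) :
    4 * √q ≤ δ ^ 2 * q ^ ((2 : ℝ) / 3) := by
  have hq0 : 0 < q := lt_of_lt_of_le (by positivity) hq
  have root : 4 / δ ^ 2 ≤ q ^ ((1 : ℝ) / 6) := by
    calc 4 / δ ^ 2 = ((4 / δ ^ 2) ^ 6) ^ ((1 : ℝ) / 6) := by
          rw [← Real.rpow_natCast (4 / δ ^ 2), ← Real.rpow_mul (by positivity)]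
          norm_num
      _ ≤ _ := Real.rpow_le_rpow (by positivity) hq (by norm_num)
  have split : q ^ ((2 : ℝ) / 3) = q ^ ((1 : ℝ) / 6) * √q := by
    rw [Real.sqrt_eq_rpow, ← Real.rpow_add hq0]
    norm_num
  rw [div_le_iff₀ (by positivity)] at root
  rw [split]
  nlinarith [mul_le_mul_of_nonneg_right root (Real.sqrt_nonneg q)]


theorem stmt_1 :
    ∃ c : ℝ, 0 < c ∧
      ∀ δ : ℝ, 0 < δ → δ ≤ 1 →
        ∃ q₀ : ℕ,
          ∀ (F : Type) [Field F] [Fintype F],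
            q₀ ≤ Fintype.card F →
            Fintype.card F % 4 = 3 →
            ∀ A : Subgroup Fˣ,
              (Fintype.card F : ℝ) ^ ((2 : ℝ) / 3) ≤ (Nat.card A : ℝ) →
              ∀ X : Set (F × F × F), X ⊆ Paraboloid F →
                δ * (Fintype.card F : ℝ) ^ 2 ≤ (X.ncard : ℝ) →
                c * (X.ncard : ℝ) ^ 4 * (Nat.card A : ℝ) ^ 2 / (Fintype.card F : ℝ) ^ 5 ≤
                  (Set.ncard {t : (F × F × F) × (F × F × F) × (F × F × F) × (F × F × F) |
                    t.1 ∈ X ∧ t.2.1 ∈ X ∧ t.2.2.1 ∈ X ∧ t.2.2.2 ∈ X ∧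
                    IsNontrivialEnergyTuple t.1 t.2.1 t.2.2.1 t.2.2.2 ∧
                    IsRect (proj t.1) (proj t.2.2.1) (proj t.2.1) (proj t.2.2.2) ∧
                    (∃ u ∈ A, (u : F) =
                      dot2 (proj t.1 - proj t.2.2.1) (proj t.1 - proj t.2.2.1)) ∧
                    (∃ u ∈ A, (u : F) =
                      dot2 (proj t.2.2.1 - proj t.2.1) (proj t.2.2.1 - proj t.2.1))} : ℝ) := by
  classical
  refine ⟨1 / 16, by norm_num, fun δ hδ hδ1 => ⟨⌈(4 / δ ^ 2) ^ 6⌉₊, ?_⟩⟩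
  intro F _ _ hq₀ hF A hA X hX hδX
  have : Fintype A := Fintype.ofFinite A
  rw [Nat.card_eq_fintype_card] at hA ⊢
  have hq : (0 : ℝ) < Fintype.card F := by exact_mod_cast Fintype.card_pos
  have hlarge := four_mul_sqrt_le hδ (Nat.ceil_le.1 hq₀)
  have hN0 : (0 : ℝ) ≤ X.ncard := Nat.cast_nonneg _
  have hcircle (m : F) := circlePoint_norm (one_add_sq_ne_zero_of_card hF m)
  set f : F → F → F → ℝ := fun m x y =>
    if liftParaboloid (rotate (circlePoint m) (x, y)) ∈ X then 1 else 0 with hf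
  have hcount := sum_rotated_rectangles_le hF A X f fun _ _ _ => rfl
  set q : ℝ := (Fintype.card F : ℝ) with hq_def
  set n : ℝ := (Fintype.card A : ℝ) with hn_def
  set N : ℝ := (X.ncard : ℝ) with hN_def
  have h₁ : 2 * √q * q ^ 2 ≤ n * N := by
    have : 2 * √q ≤ δ * n := by
      have : δ ^ 2 * q ^ ((2 : ℝ) / 3) ≤ δ * n := by
        have : δ ^ 2 ≤ δ := by nlinarith
        gcongr
      linarith [Real.sqrt_nonneg q]
    calc 2 * √q * q ^ 2 ≤ δ * n * q ^ 2 := by gcongr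
      _ = n * (δ * q ^ 2) := by ring
      _ ≤ n * N := by gcongr
  have h₂ : 4 * √q * q ^ 4 ≤ n * N ^ 2 := by
    calc 4 * √q * q ^ 4 ≤ δ ^ 2 * n * q ^ 4 := by
          refine mul_le_mul_of_nonneg_right (hlarge.trans ?_) (by positivity)
          gcongr
      _ = n * (δ * q ^ 2) ^ 2 := by ring
      _ ≤ n * N ^ 2 := by gcongr
  have hdir (m : F) := le_sum_axis_rectangles A (f m) (fun x y => by simp [hf])
    (sum_indicator_rotate hX (hcircle m)) h₁ h₂
  have htotal := (Finset.sum_le_sum fun m (_ : m ∈ Finset.univ) => hdir m).trans hcount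
  rw [Finset.sum_const, Finset.card_univ, nsmul_eq_mul, ← hq_def, ← hn_def, ← hN_def] at htotal
  have hscale : q * (n ^ 2 * N ^ 4 / (8 * q ^ 6)) = 2 * (1 / 16 * N ^ 4 * n ^ 2 / q ^ 5) := by
    field_simp
    ring
  change _ ≤ ((rectangleTuples A X).ncard : ℝ)
  linarith
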